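/- arXiv:math/0303277 — 2 statements merged into one kernel-verified Lean document; each statement's English description precedes it below -/
import Mathlib

section
/- Let n ≥ 1 and p > n/2. There exists a constant C > 0, depending only on n and p, such that for all measurable f, g : ℝⁿ → ℂ with ‖f‖_{p,n} < ∞ and ‖g‖_{p,n} < ∞, the convolution (f ⋆ g)(ξ) = ∫_{ℝⁿ} f(ξ − η) g(η) dη is defined by an absolutely convergent integral for almost every ξ ∈ ℝⁿ, and ‖f ⋆ g‖_{p,n} ≤ C · ‖f‖_{p,n} · ‖g‖_{p,n}. -/
open MeasureTheory
open scoped ENNReal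

/-- The weighted norm `‖f‖_{p,n} = (∫ (1 + ‖ξ‖)^(2p) |f ξ|² dξ)^(1/2)`. -/
noncomputable def weightedNorm (n : ℕ) (p : ℝ) (f : EuclideanSpace ℝ (Fin n) → ℂ) : ℝ≥0∞ :=
  (∫⁻ ξ, ENNReal.ofReal ((1 + ‖ξ‖) ^ (2 * p)) * (‖f ξ‖₊ : ℝ≥0∞) ^ 2) ^ ((1 : ℝ) / 2)

/-- The convolution `(f ⋆ g)(ξ) = ∫ f (ξ - η) g η dη` on `ℝⁿ`. -/
noncomputable def conv (n : ℕ) (f g : EuclideanSpace ℝ (Fin n) → ℂ) :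
    EuclideanSpace ℝ (Fin n) → ℂ :=
  fun ξ => ∫ η, f (ξ - η) * g η

/-- Cauchy–Schwarz against a weight and its inverse. -/
theorem sq_lintegral_le_weight {α : Type*} [MeasurableSpace α] {μ : Measure α}
    {X φ : α → ℝ≥0∞} (hX : Measurable X) (hφ : Measurable φ)
    (hX0 : ∀ x, X x ≠ 0) (hXt : ∀ x, X x ≠ ⊤) :
    (∫⁻ x, φ x ∂μ) ^ 2 ≤ (∫⁻ x, X x * φ x ^ 2 ∂μ) * ∫⁻ x, (X x)⁻¹ ∂μ := by
  have h := ENNReal.lintegral_mul_le_Lp_mul_Lq μ Real.HolderConjugate.two_two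
    (f := fun x => X x ^ (1 / 2 : ℝ) * φ x) (g := fun x => (X x)⁻¹ ^ (1 / 2 : ℝ))
    ((hX.pow_const _).mul hφ).aemeasurable (hX.inv.pow_const _).aemeasurable
  have e1 (x : α) : X x ^ (1 / 2 : ℝ) * φ x * (X x)⁻¹ ^ (1 / 2 : ℝ) = φ x := by
    rw [mul_right_comm, ← ENNReal.mul_rpow_of_nonneg _ _ (by norm_num),
      ENNReal.mul_inv_cancel (hX0 x) (hXt x), ENNReal.one_rpow, one_mul]
  have sqrt_sq (a : ℝ≥0∞) : (a ^ (1 / 2 : ℝ)) ^ 2 = a := by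
    rw [← ENNReal.rpow_natCast, ← ENNReal.rpow_mul]
    norm_num
  simp only [Pi.mul_apply, e1, ENNReal.rpow_two, mul_pow, sqrt_sq] at h
  calc _ ≤ _ := pow_le_pow_left' h 2
    _ = _ := by rw [mul_pow, sqrt_sq, sqrt_sq]

/-- A weighted `L²` bound for convolutions of nonnegative functions, when the weight is
subadditive up to a constant. -/
theorem lintegral_weight_mul_sq_conv_le {G : Type*} [AddCommGroup G] [MeasurableSpace G]
    [MeasurableAdd₂ G] [MeasurableNeg G] [MeasurableSub₂ G] (μ : Measure G) [SFinite μ]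
    [μ.IsAddLeftInvariant] [μ.IsNegInvariant] {W F K : G → ℝ≥0∞} {c : ℝ≥0∞}
    (hW : Measurable W) (hF : Measurable F) (hK : Measurable K)
    (hW0 : ∀ x, W x ≠ 0) (hWt : ∀ x, W x ≠ ⊤) (hc : ∀ x y, W x ≤ c * (W (x - y) + W y)) :
    ∫⁻ x, W x * (∫⁻ y, F (x - y) * K y ∂μ) ^ 2 ∂μ ≤
      c * (2 * ∫⁻ x, (W x)⁻¹ ∂μ) * (∫⁻ x, W x * F x ^ 2 ∂μ) * ∫⁻ x, W x * K x ^ 2 ∂μ := by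
  have kernel (x : G) :
      W x * ∫⁻ y, (W (x - y) * W y)⁻¹ ∂μ ≤ c * (2 * ∫⁻ x, (W x)⁻¹ ∂μ) := by
    calc W x * ∫⁻ y, (W (x - y) * W y)⁻¹ ∂μ
        = ∫⁻ y, W x * (W (x - y) * W y)⁻¹ ∂μ := by
          rw [lintegral_const_mul _ (by fun_prop)]
      _ ≤ ∫⁻ y, c * ((W y)⁻¹ + (W (x - y))⁻¹) ∂μ := by
          refine lintegral_mono fun y => ?_
          calc _ ≤ c * (W (x - y) + W y) * (W (x - y) * W y)⁻¹ := by gcongr; exact hc x y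
            _ = c * ((W (x - y) * (W (x - y))⁻¹) * (W y)⁻¹ +
                  (W y * (W y)⁻¹) * (W (x - y))⁻¹) := by
                rw [ENNReal.mul_inv (.inl (hW0 _)) (.inl (hWt _))]
                ring
            _ = _ := by
                rw [ENNReal.mul_inv_cancel (hW0 _) (hWt _),
                  ENNReal.mul_inv_cancel (hW0 _) (hWt _), one_mul, one_mul]
      _ = c * (2 * ∫⁻ x, (W x)⁻¹ ∂μ) := by
          rw [lintegral_const_mul _ (by fun_prop), lintegral_add_left (by fun_prop),
            lintegral_sub_left_eq_self (fun y => (W y)⁻¹) x, two_mul]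
  calc ∫⁻ x, W x * (∫⁻ y, F (x - y) * K y ∂μ) ^ 2 ∂μ
      ≤ ∫⁻ x, c * (2 * ∫⁻ x, (W x)⁻¹ ∂μ) *
          ∫⁻ y, (W (x - y) * F (x - y) ^ 2) * (W y * K y ^ 2) ∂μ ∂μ := by
        refine lintegral_mono fun x => ?_
        have cs := sq_lintegral_le_weight (μ := μ) (X := fun y => W (x - y) * W y)
          (φ := fun y => F (x - y) * K y) (by fun_prop) (by fun_prop)
          (fun y => mul_ne_zero (hW0 _) (hW0 _)) (fun y => ENNReal.mul_ne_top (hWt _) (hWt _))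
        calc W x * (∫⁻ y, F (x - y) * K y ∂μ) ^ 2
            ≤ W x * ((∫⁻ y, W (x - y) * W y * (F (x - y) * K y) ^ 2 ∂μ) *
                ∫⁻ y, (W (x - y) * W y)⁻¹ ∂μ) := mul_le_mul_right cs _
          _ = (W x * ∫⁻ y, (W (x - y) * W y)⁻¹ ∂μ) *
              ∫⁻ y, W (x - y) * W y * (F (x - y) * K y) ^ 2 ∂μ := by
                rw [mul_comm (lintegral _ _), mul_assoc]
          _ ≤ c * (2 * ∫⁻ x, (W x)⁻¹ ∂μ) *
              ∫⁻ y, W (x - y) * W y * (F (x - y) * K y) ^ 2 ∂μ :=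
                mul_le_mul_left (kernel x) _
          _ = c * (2 * ∫⁻ x, (W x)⁻¹ ∂μ) *
              ∫⁻ y, (W (x - y) * F (x - y) ^ 2) * (W y * K y ^ 2) ∂μ := by
                congr 2 with y
                ring
    _ = c * (2 * ∫⁻ x, (W x)⁻¹ ∂μ) *
          ∫⁻ y, ∫⁻ x, (W (x - y) * F (x - y) ^ 2) * (W y * K y ^ 2) ∂μ ∂μ := by
        rw [lintegral_const_mul _ (by fun_prop), lintegral_lintegral_swap (by fun_prop)]
    _ = c * (2 * ∫⁻ x, (W x)⁻¹ ∂μ) *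
          ∫⁻ y, (∫⁻ x, W x * F x ^ 2 ∂μ) * (W y * K y ^ 2) ∂μ := by
        congr 2 with y
        rw [lintegral_mul_const _ (by fun_prop),
          lintegral_sub_right_eq_self (fun x => W x * F x ^ 2) y]
    _ = _ := by rw [lintegral_const_mul _ (by fun_prop), mul_assoc _ (∫⁻ x, W x * F x ^ 2 ∂μ)]

/-- Powers of `1 + ‖x‖` are subadditive up to a constant. -/
theorem one_add_norm_rpow_le {E : Type*} [SeminormedAddCommGroup E] {r : ℝ} (hr : 0 ≤ r)
    (x y : E) : (1 + ‖x‖) ^ r ≤ 2 ^ r * ((1 + ‖x - y‖) ^ r + (1 + ‖y‖) ^ r) := by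
  have h : 1 + ‖x‖ ≤ 2 * max (1 + ‖x - y‖) (1 + ‖y‖) := by
    have := norm_add_le (x - y) y
    rw [sub_add_cancel] at this
    linarith [le_max_left (1 + ‖x - y‖) (1 + ‖y‖), le_max_right (1 + ‖x - y‖) (1 + ‖y‖)]
  calc (1 + ‖x‖) ^ r ≤ (2 * max (1 + ‖x - y‖) (1 + ‖y‖)) ^ r := by gcongr
    _ = 2 ^ r * max (1 + ‖x - y‖) (1 + ‖y‖) ^ r := Real.mul_rpow (by norm_num) (by positivity)
    _ ≤ _ := by
      gcongr
      have h1 : 0 ≤ (1 + ‖x - y‖) ^ r := by positivity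
      have h2 : 0 ≤ (1 + ‖y‖) ^ r := by positivity
      rcases max_choice (1 + ‖x - y‖) (1 + ‖y‖) with h | h <;> rw [h] <;> linarith

/-- **The weighted L² space is an algebra under convolution for `p > n/2`.**
There is a constant `C > 0` depending only on `n` and `p` such that for all measurable
`f, g` with finite weighted norms, `f ⋆ g` is given by an absolutely convergent integral
a.e. and `‖f ⋆ g‖_{p,n} ≤ C ‖f‖_{p,n} ‖g‖_{p,n}`. -/
theorem weightedNorm_conv_le (n : ℕ) (hn : 1 ≤ n) (p : ℝ) (hp : (n : ℝ) / 2 < p) :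
    ∃ C : ℝ≥0∞, 0 < C ∧ C < ⊤ ∧
      ∀ f g : EuclideanSpace ℝ (Fin n) → ℂ, Measurable f → Measurable g →
        weightedNorm n p f < ⊤ → weightedNorm n p g < ⊤ →
        (∀ᵐ ξ : EuclideanSpace ℝ (Fin n), Integrable fun η => f (ξ - η) * g η) ∧
        weightedNorm n p (conv n f g) ≤ C * weightedNorm n p f * weightedNorm n p g := by
  set W : EuclideanSpace ℝ (Fin n) → ℝ≥0∞ := fun ξ => ENNReal.ofReal ((1 + ‖ξ‖) ^ (2 * p))
    with hWdef
  have hp0 : 0 ≤ 2 * p := by linarith [n.cast_nonneg (α := ℝ)]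
  have hW : Measurable W := by fun_prop
  have hW0 (x) : W x ≠ 0 := by
    simp only [hWdef, ne_eq, ENNReal.ofReal_eq_zero, not_le]
    positivity
  have hWt (x) : W x ≠ ⊤ := ENNReal.ofReal_ne_top
  have hc (x y) : W x ≤ ENNReal.ofReal (2 ^ (2 * p)) * (W (x - y) + W y) := by
    rw [← ENNReal.ofReal_add (by positivity) (by positivity),
      ← ENNReal.ofReal_mul (by positivity)]
    exact ENNReal.ofReal_le_ofReal (one_add_norm_rpow_le hp0 x y)
  have hI : ∫⁻ x, (W x)⁻¹ < ⊤ := by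
    have := finite_integral_one_add_norm (E := EuclideanSpace ℝ (Fin n)) (μ := volume)
      (r := 2 * p) (by rw [finrank_euclideanSpace_fin]; linarith)
    convert this using 3 with x
    rw [Real.rpow_neg (by positivity), ENNReal.ofReal_inv_of_pos (by positivity)]
  set D : ℝ≥0∞ := ENNReal.ofReal (2 ^ (2 * p)) * (2 * ∫⁻ x, (W x)⁻¹) with hD
  have hDt : D < ⊤ := ENNReal.mul_lt_top ENNReal.ofReal_lt_top
    (ENNReal.mul_lt_top ENNReal.ofNat_lt_top hI)
  refine ⟨(D + 1) ^ ((1 : ℝ) / 2), ENNReal.rpow_pos (by positivity) (by finiteness),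
    ENNReal.rpow_lt_top_of_nonneg (by norm_num) (by finiteness), ?_⟩
  intro f g hf hg hfn hgn
  have hfin (h : EuclideanSpace ℝ (Fin n) → ℂ) (hh : weightedNorm n p h < ⊤) :
      ∫⁻ ξ, W ξ * ‖h ξ‖ₑ ^ 2 < ⊤ :=
    (ENNReal.rpow_lt_top_iff_of_pos (by norm_num)).1 hh
  have key := lintegral_weight_mul_sq_conv_le volume hW hf.enorm hg.enorm hW0 hWt hc
  rw [← hD] at key
  refine ⟨?_, ?_⟩
  · have hlt := key.trans_lt
      (ENNReal.mul_lt_top (ENNReal.mul_lt_top hDt (hfin f hfn)) (hfin g hgn))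
    filter_upwards [ae_lt_top (by fun_prop) hlt.ne] with ξ hξ
    refine ⟨by fun_prop, ?_⟩
    simp only [HasFiniteIntegral, enorm_mul]
    by_contra htop
    rw [not_lt_top_iff] at htop
    simp [htop, ENNReal.mul_top (hW0 ξ)] at hξ
  · unfold weightedNorm
    rw [← ENNReal.mul_rpow_of_nonneg _ _ (by norm_num),
      ← ENNReal.mul_rpow_of_nonneg _ _ (by norm_num)]
    refine ENNReal.rpow_le_rpow ?_ (by norm_num)
    calc ∫⁻ ξ, W ξ * ‖conv n f g ξ‖ₑ ^ 2
        ≤ ∫⁻ ξ, W ξ * (∫⁻ η, ‖f (ξ - η)‖ₑ * ‖g η‖ₑ) ^ 2 := by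
          refine lintegral_mono fun ξ => ?_
          gcongr
          simpa only [conv, enorm_mul] using
            enorm_integral_le_lintegral_enorm (fun η => f (ξ - η) * g η)
      _ ≤ D * (∫⁻ ξ, W ξ * ‖f ξ‖ₑ ^ 2) * ∫⁻ ξ, W ξ * ‖g ξ‖ₑ ^ 2 := key
      _ ≤ (D + 1) * (∫⁻ ξ, W ξ * ‖f ξ‖ₑ ^ 2) * ∫⁻ ξ, W ξ * ‖g ξ‖ₑ ^ 2 := by
          gcongr
          exact le_self_add
end

section
/- Let μ ∈ ℝ and let w : ℝ² → ℝ be a Schwartz function. Then there exists a smooth function φ : ℝ² → ℝ such that ∂²φ/∂x² + ∂²φ/∂y² = μ·∂w/∂x at every point of ℝ², and ‖∇φ(x,y)‖ → 0 as x² + y² → ∞. -/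
open Filter
open scoped Topology

open MeasureTheory FourierTransform

section Fourier

variable {V : Type*} [NormedAddCommGroup V] [InnerProductSpace ℝ V] [FiniteDimensional ℝ V]
  [MeasurableSpace V] [BorelSpace V]

/-- A Schwartz function divided by the norm has all moments in dimension at least two. -/
lemma SchwartzMap.integrable_pow_mul_inv_norm (hV : 2 ≤ Module.finrank ℝ V)
    (g : SchwartzMap V ℂ) (n : ℕ) :
    Integrable (fun ξ => ‖ξ‖ ^ n * (‖ξ‖⁻¹ * ‖g ξ‖)) := by
  have hmeas : ∀ m : ℕ, AEStronglyMeasurable (fun ξ => ‖ξ‖ ^ m * (‖ξ‖⁻¹ * ‖g ξ‖)) := fun m =>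
    ((measurable_norm.pow_const m).mul
      (measurable_norm.inv.mul g.continuous.norm.measurable)).aestronglyMeasurable
  cases n with
  | succ n =>
    refine (g.integrable_pow_mul volume n).mono' (hmeas _) (.of_forall fun ξ => ?_)
    rw [Real.norm_of_nonneg (by positivity)]
    calc ‖ξ‖ ^ (n + 1) * (‖ξ‖⁻¹ * ‖g ξ‖) = ‖ξ‖ ^ n * ‖g ξ‖ * (‖ξ‖ * ‖ξ‖⁻¹) := by ring
      _ ≤ ‖ξ‖ ^ n * ‖g ξ‖ * 1 := by gcongr; exact mul_inv_le_one
      _ = _ := mul_one _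
  | zero =>
    rw [← integrableOn_univ, ← Set.union_compl_self (Metric.ball (0 : V) 1)]
    refine IntegrableOn.union ?_ ?_
    · refine integrableOn_ball_of_norm_le_rpow (by omega) (α := 1)
        (C := SchwartzMap.seminorm ℝ 0 0 g)
        (by exact_mod_cast (by omega : 1 < Module.finrank ℝ V)) (.of_forall fun ξ => ?_) (hmeas 0)
      rw [Real.norm_of_nonneg (by positivity), Real.rpow_neg_one, pow_zero, one_mul, mul_comm]
      gcongr
      exact g.norm_le_seminorm ℝ ξ
    · refine Integrable.mono' g.integrable.norm.integrableOn (hmeas 0).restrict ?_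
      filter_upwards [ae_restrict_mem Metric.isOpen_ball.measurableSet.compl] with ξ hξ
      have h1 : 1 ≤ ‖ξ‖ := by simpa using hξ
      rw [Real.norm_of_nonneg (by positivity), pow_zero, one_mul]
      exact mul_le_of_le_one_left (norm_nonneg _) (inv_le_one_of_one_le₀ h1)

/-- The directional derivative of a Fourier transform. -/
lemma fderiv_fourier_apply {f : V → ℂ} (hf : Integrable f)
    (hf' : Integrable (fun ξ => ‖ξ‖ * ‖f ξ‖)) (x v : V) :
    fderiv ℝ (𝓕 f) x v =
      𝓕 (fun ξ => -(2 * Real.pi * Complex.I) * ((inner ℝ ξ v : ℝ) * f ξ)) x := by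
  have hint : Integrable (VectorFourier.fourierSMulRight (innerSL ℝ) f) := by
    refine (hf'.const_mul (2 * Real.pi * ‖innerSL ℝ (E := V)‖)).mono'
      hf.aestronglyMeasurable.fourierSMulRight (.of_forall fun ξ => ?_)
    rw [← mul_assoc]
    exact VectorFourier.norm_fourierSMulRight_le _ _ _
  rw [Real.fderiv_fourier hf hf', Real.fourier_continuousLinearMap_apply hint]
  congr 1

lemma integrable_pow_mul_norm_inner_mul {f : V → ℂ} (hm : AEStronglyMeasurable f)
    (hf : ∀ n : ℕ, Integrable (fun ξ => ‖ξ‖ ^ n * ‖f ξ‖)) (v : V) (c : ℂ) (n : ℕ) :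
    Integrable (fun ξ => ‖ξ‖ ^ n * ‖c * ((inner ℝ ξ v : ℝ) * f ξ)‖) := by
  refine ((hf (n + 1)).const_mul (‖c‖ * ‖v‖)).mono' ?_ (.of_forall fun ξ => ?_)
  · refine (continuous_norm.pow n).aestronglyMeasurable.mul
      (AEStronglyMeasurable.norm (aestronglyMeasurable_const.mul (.mul ?_ hm)))
    exact Continuous.aestronglyMeasurable (by fun_prop)
  · rw [Real.norm_of_nonneg (by positivity), norm_mul, norm_mul, Complex.norm_real]
    calc _ ≤ ‖ξ‖ ^ n * (‖c‖ * (‖ξ‖ * ‖v‖ * ‖f ξ‖)) := by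
          gcongr; exact norm_inner_le_norm ξ v
      _ = _ := by ring

lemma integrable_of_pow_mul_norm {f : V → ℂ} (hm : AEStronglyMeasurable f)
    (hf : ∀ n : ℕ, Integrable (fun ξ => ‖ξ‖ ^ n * ‖f ξ‖)) : Integrable f :=
  (integrable_norm_iff hm).1 (by simpa using hf 0)

lemma fderiv_fderiv_fourier_apply {f : V → ℂ} (hm : AEStronglyMeasurable f)
    (hf : ∀ n : ℕ, Integrable (fun ξ => ‖ξ‖ ^ n * ‖f ξ‖)) (x v : V) :
    fderiv ℝ (fun y => fderiv ℝ (𝓕 f) y v) x v =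
      𝓕 (fun ξ => -(2 * Real.pi * Complex.I) * ((inner ℝ ξ v : ℝ) *
        (-(2 * Real.pi * Complex.I) * ((inner ℝ ξ v : ℝ) * f ξ)))) x := by
  have hf1 : Integrable (fun ξ => ‖ξ‖ * ‖f ξ‖) := by simpa using hf 1
  have hm' : AEStronglyMeasurable
      (fun ξ => -(2 * Real.pi * Complex.I) * ((inner ℝ ξ v : ℝ) * f ξ)) :=
    aestronglyMeasurable_const.mul
      (.mul (Continuous.aestronglyMeasurable (by fun_prop)) hm)
  have hf' := integrable_pow_mul_norm_inner_mul hm hf v (-(2 * Real.pi * Complex.I))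
  rw [← fderiv_fourier_apply (integrable_of_pow_mul_norm hm' hf')
    (by simpa only [pow_one] using hf' 1)]
  congr 2
  ext y
  exact fderiv_fourier_apply (integrable_of_pow_mul_norm hm hf) hf1 y v

end Fourier

lemma exists_complex_poisson_gradient_decay (μ : ℝ) (W : SchwartzMap ℂ ℂ) :
    ∃ Φ : ℂ → ℂ, ContDiff ℝ (⊤ : ℕ∞) Φ ∧
      (∀ z : ℂ, fderiv ℝ (fun y => fderiv ℝ Φ y 1) z 1 +
          fderiv ℝ (fun y => fderiv ℝ Φ y Complex.I) z Complex.I = μ * fderiv ℝ W z 1) ∧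
      Tendsto (fderiv ℝ Φ) (cocompact ℂ) (𝓝 0) := by
  set g : SchwartzMap ℂ ℂ := 𝓕⁻ W with hg
  have hW : 𝓕 (g : ℂ → ℂ) = W := by
    rw [← SchwartzMap.fourier_coe, hg, FourierInvPair.fourier_fourierInv_eq]
  set c : ℂ := μ * Complex.I / (2 * Real.pi) with hc
  set f : ℂ → ℂ := fun ξ => c * (((ξ.re / Complex.normSq ξ : ℝ) : ℂ) * g ξ) with hfdef
  have hm : AEStronglyMeasurable f := by
    refine aestronglyMeasurable_const.mul (.mul ?_ g.continuous.aestronglyMeasurable)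
    exact (Complex.measurable_ofReal.comp
      (Complex.measurable_re.div Complex.continuous_normSq.measurable)).aestronglyMeasurable
  have hf : ∀ n : ℕ, Integrable (fun ξ => ‖ξ‖ ^ n * ‖f ξ‖) := fun n => by
    refine ((g.integrable_pow_mul_inv_norm (by simp) n).const_mul ‖c‖).mono'
      ((continuous_norm.pow n).aestronglyMeasurable.mul hm.norm) (.of_forall fun ξ => ?_)
    have hξ : ‖ξ.re / Complex.normSq ξ‖ ≤ ‖ξ‖⁻¹ := by
      rw [norm_div, Complex.normSq_eq_norm_sq, norm_pow, norm_norm]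
      rcases eq_or_ne ξ 0 with rfl | h
      · simp
      · have := norm_pos_iff.2 h
        rw [div_le_iff₀ (by positivity), pow_two, inv_mul_cancel_left₀ this.ne']
        exact Complex.abs_re_le_norm ξ
    rw [Real.norm_of_nonneg (by positivity), hfdef]
    simp only [norm_mul, Complex.norm_real]
    calc _ ≤ ‖ξ‖ ^ n * (‖c‖ * (‖ξ‖⁻¹ * ‖g ξ‖)) := by gcongr
      _ = _ := by ring
  have hfi := integrable_of_pow_mul_norm hm hf
  have hf1 : Integrable (fun ξ => ‖ξ‖ * ‖f ξ‖) := by simpa using hf 1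
  refine ⟨𝓕 f, Real.contDiff_fourier fun n _ => hf n, fun z => ?_, ?_⟩
  · have hint : ∀ v : ℂ, Integrable (fun ξ : ℂ => -(2 * Real.pi * Complex.I) *
        ((inner ℝ ξ v : ℝ) * (-(2 * Real.pi * Complex.I) * ((inner ℝ ξ v : ℝ) * f ξ)))) :=
      fun v => by
      have hm1 : AEStronglyMeasurable
          (fun ξ => -(2 * Real.pi * Complex.I) * ((inner ℝ ξ v : ℝ) * f ξ)) :=
        aestronglyMeasurable_const.mul (.mul (Continuous.aestronglyMeasurable (by fun_prop)) hm)
      refine integrable_of_pow_mul_norm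
        (aestronglyMeasurable_const.mul
          (.mul (Continuous.aestronglyMeasurable (by fun_prop)) hm1)) ?_
      exact integrable_pow_mul_norm_inner_mul hm1
        (integrable_pow_mul_norm_inner_mul hm hf v _) v _
    rw [fderiv_fderiv_fourier_apply hm hf, fderiv_fderiv_fourier_apply hm hf, ← hW,
      fderiv_fourier_apply g.integrable (by simpa using g.integrable_pow_mul volume 1),
      ← smul_eq_mul (μ : ℂ), ← Pi.add_apply]
    simp only [Pi.add_apply, Real.fourier_eq]
    rw [← integral_add ((Real.fourierIntegral_convergent_iff z).2 (hint 1))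
      ((Real.fourierIntegral_convergent_iff z).2 (hint Complex.I)), ← integral_smul]
    congr 1
    ext ξ
    rw [← smul_add, smul_comm (μ : ℂ)]
    congr 1
    have hre : inner ℝ ξ 1 = ξ.re := by simp [Complex.inner]
    have him : inner ℝ ξ Complex.I = ξ.im := by simp [Complex.inner]
    rw [hre, him, hfdef, hc]
    rcases eq_or_ne ξ 0 with rfl | h
    · simp
    · have hn : (Complex.normSq ξ : ℂ) ≠ 0 := by simpa using h
      have hn' : (Complex.normSq ξ : ℂ) = ξ.re * ξ.re + ξ.im * ξ.im := by
        rw [Complex.normSq_apply]; push_cast; ring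
      have hpi : (Real.pi : ℂ) ≠ 0 := by exact_mod_cast Real.pi_ne_zero
      push_cast
      simp only [smul_eq_mul]
      calc _ = (2 * Real.pi * Complex.I) * (2 * Real.pi * Complex.I)
            * (ξ.re * ξ.re + ξ.im * ξ.im) * (μ * Complex.I / (2 * Real.pi)
              * (ξ.re / Complex.normSq ξ * g ξ)) := by ring
        _ = _ := by
          rw [← hn']
          field_simp
          linear_combination (μ * ξ.re * g ξ) * Complex.I_sq
  · rw [Real.fderiv_fourier hfi hf1]
    exact tendsto_integral_exp_inner_smul_cocompact _

/-- **Solvability of the mean-flow equation.** For `μ ∈ ℝ` and a Schwartz function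
`w : ℝ² → ℝ` there is a smooth `φ : ℝ² → ℝ` with `φ_{xx} + φ_{yy} = μ w_x` everywhere
and `∇φ → 0` at spatial infinity (i.e. along the cocompact filter of `ℝ²`). -/
theorem poisson_gradient_decay (μ : ℝ) (w : SchwartzMap (ℝ × ℝ) ℝ) :
    ∃ φ : ℝ × ℝ → ℝ, ContDiff ℝ (⊤ : ℕ∞) φ ∧
      (∀ q : ℝ × ℝ,
        fderiv ℝ (fun x => fderiv ℝ φ x ((1 : ℝ), (0 : ℝ))) q ((1 : ℝ), (0 : ℝ)) +
          fderiv ℝ (fun x => fderiv ℝ φ x ((0 : ℝ), (1 : ℝ))) q ((0 : ℝ), (1 : ℝ)) =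
        μ * fderiv ℝ (⇑w) q ((1 : ℝ), (0 : ℝ))) ∧
      Tendsto (fun q : ℝ × ℝ => ‖fderiv ℝ φ q‖) (cocompact (ℝ × ℝ)) (𝓝 0) := by
  set A : ℂ ≃L[ℝ] ℝ × ℝ := Complex.equivRealProdCLM
  set W : SchwartzMap ℂ ℂ := SchwartzMap.postcompCLM Complex.ofRealCLM
    (SchwartzMap.compCLMOfContinuousLinearEquiv ℝ A w) with hWdef
  obtain ⟨Φ, hΦ, heq, hlim⟩ := exists_complex_poisson_gradient_decay μ W
  have hΦd : Differentiable ℝ Φ := hΦ.differentiable (by simp)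
  have hre : ∀ {F : ℂ → ℂ}, Differentiable ℝ F → ∀ q : ℝ × ℝ,
      fderiv ℝ (fun x => (F (A.symm x)).re) q =
        Complex.reCLM ∘L (fderiv ℝ F (A.symm q) ∘L (A.symm : ℝ × ℝ →L[ℝ] ℂ)) := fun hF q =>
    (Complex.reCLM.hasFDerivAt.comp q
      ((hF (A.symm q)).hasFDerivAt.comp q A.symm.hasFDerivAt)).fderiv
  have hdd : ∀ v : ℂ, Differentiable ℝ fun y => fderiv ℝ Φ y v := fun v =>
    ((hΦ.fderiv_right (m := 1) (by norm_cast)).clm_apply contDiff_const).differentiable (by simp)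
  have hA1 : A.symm ((1 : ℝ), (0 : ℝ)) = 1 := by
    rw [ContinuousLinearEquiv.symm_apply_eq]; simp [A]
  have hAI : A.symm ((0 : ℝ), (1 : ℝ)) = Complex.I := by
    rw [ContinuousLinearEquiv.symm_apply_eq]; simp [A]
  have hw : ∀ q, fderiv ℝ w q = Complex.reCLM ∘L
      (fderiv ℝ W (A.symm q) ∘L (A.symm : ℝ × ℝ →L[ℝ] ℂ)) := fun q => by
    rw [← hre W.differentiable]
    congr 1
  refine ⟨fun q => (Φ (A.symm q)).re, Complex.reCLM.contDiff.comp (hΦ.comp A.symm.contDiff),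
    fun q => ?_, ?_⟩
  · have h := congrArg Complex.re (heq (A.symm q))
    simp only [hre hΦd, hw, ContinuousLinearMap.comp_apply, ContinuousLinearEquiv.coe_coe, hA1,
      hAI, Complex.reCLM_apply]
    rw [hre (hdd 1), hre (hdd Complex.I)]
    simpa [hA1, hAI] using h
  · simp only [hre hΦd]
    have hcomp := hlim.comp A.symm.toHomeomorph.isClosedEmbedding.tendsto_cocompact
    have hcont : Continuous fun T : ℂ →L[ℝ] ℂ =>
        ‖Complex.reCLM ∘L (T ∘L (A.symm : ℝ × ℝ →L[ℝ] ℂ))‖ := by fun_prop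
    simpa [Function.comp_def] using (hcont.tendsto 0).comp hcomp
end
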